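/- For X ∈ 𝔤 define δ_X : A → A by δ_X(λ)(u) = λ(u·ι'(X)). Then δ_X is well defined (maps A to A) and is a k-derivation of the algebra A; the map X ↦ δ_X is a Lie algebra homomorphism, i.e. δ_{[X,Y]} = δ_X ∘ δ_Y − δ_Y ∘ δ_X for all X, Y ∈ 𝔤; and δ_{x^[p]} = (δ_x)^p for all x ∈ 𝔤. -/

import Mathlib

open TensorProduct

noncomputable section

/-- The relation on `U(𝔤)` whose closure defines the restricted enveloping algebra. -/
def rRel (k : Type*) [Field k] (L : Type*) [LieRing L] [LieAlgebra k L]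
    (p : ℕ) (pOp : L → L) :
    UniversalEnvelopingAlgebra k L → UniversalEnvelopingAlgebra k L → Prop :=
  fun x y => ∃ X : L,
    x = UniversalEnvelopingAlgebra.ι k X ^ p ∧ y = UniversalEnvelopingAlgebra.ι k (pOp X)

/-- The restricted enveloping algebra `U'(𝔤) = U(𝔤)/I`. -/
abbrev RUEA (k : Type*) [Field k] (L : Type*) [LieRing L] [LieAlgebra k L]
    (p : ℕ) (pOp : L → L) : Type _ :=
  RingQuot (rRel k L p pOp)

/-- `ι' : 𝔤 → U'(𝔤)`, the composite of `ι` with the quotient map. -/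
def rι (k : Type*) [Field k] {L : Type*} [LieRing L] [LieAlgebra k L]
    (p : ℕ) (pOp : L → L) (X : L) : RUEA k L p pOp :=
  RingQuot.mkAlgHom k (rRel k L p pOp) (UniversalEnvelopingAlgebra.ι k X)

section

variable {k : Type*} [Field k] {L : Type*} [LieRing L] [LieAlgebra k L]
  (p : ℕ) (pOp : L → L) {H : LieSubalgebra k L} {pOpH : H → H}

/-- The convolution product on `Hom_k(U'(𝔤), k)`. -/
def rConv (Δ' : RUEA k L p pOp →ₐ[k] (RUEA k L p pOp ⊗[k] RUEA k L p pOp))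
    (lam mu : RUEA k L p pOp →ₗ[k] k) : RUEA k L p pOp →ₗ[k] k :=
  (TensorProduct.lid k k).toLinearMap ∘ₗ TensorProduct.map lam mu ∘ₗ Δ'.toLinearMap

/-- `A = Hom_{U'(𝔥)}(U'(𝔤), k)` for the trivial one-dimensional `U'(𝔥)`-module. -/
def trivCoindSet (φ : RUEA k H p pOpH →ₐ[k] RUEA k L p pOp)
    (εH : RUEA k H p pOpH →ₐ[k] k) :
    Set (RUEA k L p pOp →ₗ[k] k) :=
  {lam | ∀ (w : RUEA k H p pOpH) (u : RUEA k L p pOp),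
    lam (φ w * u) = εH w * lam u}

/-- `δ_X : λ ↦ (u ↦ λ(u·ι'(X)))`, as a linear endomorphism of `Hom_k(U'(𝔤), k)`. -/
def rDelta (X : L) : (RUEA k L p pOp →ₗ[k] k) →ₗ[k] (RUEA k L p pOp →ₗ[k] k) :=
  LinearMap.lcomp k k (LinearMap.mulRight k (rι k p pOp X))

end

section

variable {k : Type*} [Field k] {L : Type*} [LieRing L] [LieAlgebra k L]
  (p : ℕ) (pOp : L → L)

theorem rι_lie (X Y : L) :
    rι k p pOp ⁅X, Y⁆ = rι k p pOp X * rι k p pOp Y - rι k p pOp Y * rι k p pOp X := by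
  simp only [rι, LieHom.map_lie, LieRing.of_associative_ring_bracket, map_sub, map_mul]

theorem rι_pOp (X : L) : rι k p pOp (pOp X) = rι k p pOp X ^ p := by
  rw [rι, rι, ← map_pow]
  exact (RingQuot.mkAlgHom_rel k ⟨X, rfl, rfl⟩).symm

theorem rDelta_apply (X : L) (lam : RUEA k L p pOp →ₗ[k] k) (u : RUEA k L p pOp) :
    rDelta p pOp X lam u = lam (u * rι k p pOp X) :=
  rfl

theorem rDelta_pow_apply (X : L) (n : ℕ) (lam : RUEA k L p pOp →ₗ[k] k)
    (u : RUEA k L p pOp) :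
    (rDelta p pOp X ^ n) lam u = lam (u * rι k p pOp X ^ n) := by
  induction n generalizing u with
  | zero => simp
  | succ n ih =>
    rw [pow_succ', Module.End.mul_apply, rDelta_apply, ih, mul_assoc, ← pow_succ']

theorem rDelta_rConv
    (Δ' : RUEA k L p pOp →ₐ[k] (RUEA k L p pOp ⊗[k] RUEA k L p pOp)) (X : L)
    (hX : Δ' (rι k p pOp X) = rι k p pOp X ⊗ₜ[k] 1 + 1 ⊗ₜ[k] rι k p pOp X)
    (lam mu : RUEA k L p pOp →ₗ[k] k) :
    rDelta p pOp X (rConv p pOp Δ' lam mu)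
      = rConv p pOp Δ' (rDelta p pOp X lam) mu
        + rConv p pOp Δ' lam (rDelta p pOp X mu) := by
  ext u
  simp only [rDelta_apply, rConv, LinearMap.add_apply, LinearMap.comp_apply,
    AlgHom.toLinearMap_apply, map_mul, hX]
  induction Δ' u using TensorProduct.induction_on with
  | zero => simp only [zero_mul, map_zero, add_zero]
  | tmul a b =>
    simp only [mul_add, Algebra.TensorProduct.tmul_mul_tmul, mul_one, map_add,
      TensorProduct.map_tmul, rDelta_apply]
  | add s t hs ht =>
    simp only [add_mul, map_add, hs, ht]
    exact add_add_add_comm _ _ _ _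

end

/-- For `X ∈ 𝔤`, the map `δ_X(λ)(u) = λ(u·ι'(X))` maps `A = Hom_{U'(𝔥)}(U'(𝔤), k)`
to itself and is a `k`-derivation of the convolution algebra `A`; moreover
`X ↦ δ_X` is a Lie algebra homomorphism (`δ_{[X,Y]} = δ_X∘δ_Y − δ_Y∘δ_X`) and is
restricted (`δ_{x^[p]} = (δ_x)^p`). -/
theorem statement17
    {k : Type*} [Field k] {L : Type*} [LieRing L] [LieAlgebra k L]
    (p : ℕ) [CharP k p] (hp : 2 < p)
    (pOp : L → L)
    (hi : ∀ x y : L, ⁅pOp x, y⁆ = (LieAlgebra.ad k L x ^ p) y)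
    (hii : ∀ (c : k) (x : L), pOp (c • x) = c ^ p • pOp x)
    (hiii : ∀ x y : L,
      UniversalEnvelopingAlgebra.ι k (pOp (x + y)) - UniversalEnvelopingAlgebra.ι k (pOp x)
          - UniversalEnvelopingAlgebra.ι k (pOp y)
        = UniversalEnvelopingAlgebra.ι k (x + y) ^ p - UniversalEnvelopingAlgebra.ι k x ^ p
          - UniversalEnvelopingAlgebra.ι k y ^ p)
    (H : LieSubalgebra k L)
    (pOpH : H → H) (hpOpH : ∀ h : H, (pOpH h : L) = pOp (h : L))
    (φ : RUEA k H p pOpH →ₐ[k] RUEA k L p pOp)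
    (hφ : ∀ h : H, φ (rι k p pOpH h) = rι k p pOp (h : L))
    (Δ' : RUEA k L p pOp →ₐ[k] (RUEA k L p pOp ⊗[k] RUEA k L p pOp))
    (hΔ' : ∀ X : L, Δ' (rι k p pOp X)
      = rι k p pOp X ⊗ₜ[k] 1 + 1 ⊗ₜ[k] rι k p pOp X)
    (εH : RUEA k H p pOpH →ₐ[k] k)
    (hεH : ∀ h : H, εH (rι k p pOpH h) = 0) :
    (∀ X : L, ∀ lam ∈ trivCoindSet p pOp φ εH,
      rDelta p pOp X lam ∈ trivCoindSet p pOp φ εH) ∧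
    (∀ X : L, ∀ lam ∈ trivCoindSet p pOp φ εH, ∀ mu ∈ trivCoindSet p pOp φ εH,
      rDelta p pOp X (rConv p pOp Δ' lam mu)
        = rConv p pOp Δ' (rDelta p pOp X lam) mu
          + rConv p pOp Δ' lam (rDelta p pOp X mu)) ∧
    (∀ X Y : L, rDelta p pOp (k := k) ⁅X, Y⁆
      = rDelta p pOp X ∘ₗ rDelta p pOp Y - rDelta p pOp Y ∘ₗ rDelta p pOp X) ∧
    (∀ x : L, rDelta p pOp (k := k) (pOp x) = rDelta p pOp x ^ p) := by
  refine ⟨fun X lam hlam w u => ?_, fun X lam _ mu _ => rDelta_rConv p pOp Δ' X (hΔ' X) lam mu,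
    fun X Y => ?_, fun x => ?_⟩
  · rw [rDelta_apply, rDelta_apply, mul_assoc, hlam]
  · refine LinearMap.ext fun lam => LinearMap.ext fun u => ?_
    simp only [LinearMap.sub_apply, LinearMap.comp_apply, rDelta_apply, rι_lie, mul_sub,
      map_sub, mul_assoc]
  · refine LinearMap.ext fun lam => LinearMap.ext fun u => ?_
    rw [rDelta_pow_apply, rDelta_apply, rι_pOp]
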